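/- arXiv:1412.0211 — 2 statements merged into one kernel-verified Lean document; each statement's English description precedes it below -/
import Mathlib

section
/- Let F : C → D be a strong monoidal functor between rigid monoidal categories with adjoint triple L ⊣ F ⊣ R, and suppose R has a right adjoint, with relative modular object χ (so R ≅ L(- ⊗ χ)). Then there are also natural isomorphisms R(V) ≅ L(χ ⊗ V), L(V) ≅ R(χ^* ⊗ V), and L(V) ≅ R(V ⊗ χ^*) for V ∈ D. -/
open CategoryTheory MonoidalCategory

universe v₁ v₂ u₁ u₂

variable {C : Type u₁} [Category.{v₁} C] [MonoidalCategory C] [RigidCategory C]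
variable {D : Type u₂} [Category.{v₂} D] [MonoidalCategory D] [RigidCategory D]

/-- For a functor `T` between rigid categories, `T^!(X) = ʸ(T(X^*))`:
the right dual of `T` applied to the left dual of `X`.
(The paper's left dual `X^*` is Mathlib's `Xᘁ` and the paper's right dual `ʸX` is `ᘁX`.) -/
noncomputable def shriek (T : C ⥤ D) : C ⥤ D where
  obj X := ᘁ(T.obj (Xᘁ))
  map f := ᘁ(T.map (fᘁ))
  map_id X := by simp
  map_comp f g := by simp [comp_rightAdjointMate, comp_leftAdjointMate]

/-- For a functor `T` between rigid categories, `ʸT(X) = (T(ʸX))^*`. -/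
noncomputable def shriek' (T : C ⥤ D) : C ⥤ D where
  obj X := (T.obj (ᘁX))ᘁ
  map f := (T.map (ᘁf))ᘁ
  map_id X := by simp
  map_comp f g := by simp [comp_rightAdjointMate, comp_leftAdjointMate]

namespace S6
open ExactPairing Functor.LaxMonoidal Functor.OplaxMonoidal

@[reducible]
noncomputable def mapPairing (F : C ⥤ D) [F.Monoidal] (X Y : C) [ExactPairing X Y] :
    ExactPairing (F.obj X) (F.obj Y) where
  coevaluation' := ε F ≫ F.map (η_ X Y) ≫ δ F _ _
  evaluation' := μ F _ _ ≫ F.map (ε_ X Y) ≫ η F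
  coevaluation_evaluation' := by
    have h := congrArg F.map (coevaluation_evaluation X Y)
    simp only [Functor.map_comp, Functor.Monoidal.map_whiskerLeft, Functor.Monoidal.map_whiskerRight, Functor.Monoidal.map_associator_inv, Functor.Monoidal.map_rightUnitor, Functor.Monoidal.map_leftUnitor_inv, Category.assoc, Functor.Monoidal.μ_δ_assoc] at h
    have h2 := congrArg (fun t => F.obj Y ◁ ε F ≫ μ F _ _ ≫ t ≫ δ F _ _ ≫ η F ▷ F.obj Y) h
    simpa only [MonoidalCategory.whiskerLeft_comp, comp_whiskerRight, Category.assoc, Functor.Monoidal.μ_δ_assoc, Functor.Monoidal.whiskerLeft_ε_η_assoc, Functor.Monoidal.whiskerRight_ε_η, Category.comp_id] using h2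
  evaluation_coevaluation' := by
    have h := congrArg F.map (evaluation_coevaluation X Y)
    simp only [Functor.map_comp, Functor.Monoidal.map_whiskerLeft, Functor.Monoidal.map_whiskerRight, Functor.Monoidal.map_associator, Functor.Monoidal.map_leftUnitor, Functor.Monoidal.map_rightUnitor_inv, Category.assoc, Functor.Monoidal.μ_δ_assoc] at h
    have h2 := congrArg (fun t => ε F ▷ F.obj X ≫ μ F _ _ ≫ t ≫ δ F _ _ ≫ F.obj X ◁ η F) h
    simpa only [MonoidalCategory.whiskerLeft_comp, comp_whiskerRight, Category.assoc, Functor.Monoidal.μ_δ_assoc, Functor.Monoidal.whiskerRight_ε_η_assoc, Functor.Monoidal.whiskerLeft_ε_η, Category.comp_id] using h2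

theorem map_ev (F : C ⥤ D) [F.Monoidal] (X Y : C) [ExactPairing X Y] :
    @evaluation _ _ _ _ _ (mapPairing F X Y) = μ F _ _ ≫ F.map (ε_ X Y) ≫ η F := rfl

theorem map_crit (F : C ⥤ D) [F.Monoidal] {X X' Y Y' : C} [ExactPairing X' X] [ExactPairing Y' Y]
    (f : X ⟶ Y) (f' : Y' ⟶ X') (h : X ◁ f' ≫ ε_ X' X = f ▷ Y' ≫ ε_ Y' Y) :
    F.obj X ◁ F.map f' ≫ @evaluation _ _ _ _ _ (mapPairing F X' X) =
      F.map f ▷ F.obj Y' ≫ @evaluation _ _ _ _ _ (mapPairing F Y' Y) := by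
  rw [map_ev, map_ev, μ_natural_right_assoc, μ_natural_left_assoc, ← F.map_comp_assoc,
    ← F.map_comp_assoc, h]

theorem conj_tensorRight {X X' Y Y' : D} [ExactPairing X' X] [ExactPairing Y' Y]
    (f : X ⟶ Y) (f' : Y' ⟶ X') (h : X ◁ f' ≫ ε_ X' X = f ▷ Y' ≫ ε_ Y' Y) :
    conjugateEquiv (tensorRightAdjunction X' X) (tensorRightAdjunction Y' Y)
      ((tensoringRight D).map f') = (tensoringRight D).map f := by
  ext V
  have h0 : ∀ (W Z : D) (g : W ⊗ Y' ⟶ Z), (tensorRightAdjunction Y' Y).homEquiv W Z g = 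
      (tensorRightHomEquiv W Y' Y Z) g := by
    intro W Z g
    simp [tensorRightAdjunction]
  have h3 : ((tensorRightAdjunction X' X).counit.app V : (V ⊗ X) ⊗ X' ⟶ V) =
      (α_ _ _ _).hom ≫ _ ◁ ε_ _ _ ≫ (ρ_ _).hom := by
    simp [tensorRightAdjunction, tensorRightHomEquiv]
  have h1 : (conjugateEquiv (tensorRightAdjunction X' X) (tensorRightAdjunction Y' Y)
      ((tensoringRight D).map f')).app V = (tensorRightAdjunction Y' Y).homEquiv _ _ 
        ((V ⊗ X) ◁ f' ≫ (tensorRightAdjunction X' X).counit.app V) := by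
    rw [conjugateEquiv_apply_app, Adjunction.homEquiv_unit, Functor.map_comp]
    rfl
  rw [h1, h0, h3]
  symm
  change V ◁ f = _
  rw [← Equiv.symm_apply_eq]
  have h4 : (tensorRightHomEquiv (V ⊗ X) Y' Y V).symm (V ◁ f) =
    (V ◁ f) ▷ _ ≫ (α_ _ _ _).hom ≫ _ ◁ ε_ _ _ ≫ (ρ_ _).hom := rfl
  refine h4.trans ?_
  have h5 := congrArg (fun t => V ◁ t) h
  simp only [MonoidalCategory.whiskerLeft_comp] at h5
  simp [reassoc_of% h5]

theorem mate_ext {X X' Z : D} [p : ExactPairing X' X] {a b : Z ⟶ X'}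
    (h : X ◁ a ≫ ε_ X' X = X ◁ b ≫ ε_ X' X) : a = b := by
  have h2 := congrArg (tensorLeftHomEquiv _ X' X _) h
  have ha := @tensorLeftHomEquiv_whiskerLeft_comp_evaluation _ _ _ Z X ⟨X'⟩ a
  have hb := @tensorLeftHomEquiv_whiskerLeft_comp_evaluation _ _ _ Z X ⟨X'⟩ b
  have h3 := ha.symm.trans (h2.trans hb)
  rwa [cancel_mono] at h3

theorem mate_ext' {Y Y' Z : D} [p : ExactPairing Y' Y] {a b : Z ⟶ Y}
    (h : a ▷ Y' ≫ ε_ Y' Y = b ▷ Y' ≫ ε_ Y' Y) : a = b := by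
  have h2 := congrArg (tensorRightHomEquiv _ Y' Y _) h
  have ha := @tensorRightHomEquiv_whiskerRight_comp_evaluation _ _ _ Y' Z ⟨Y⟩ a
  have hb := @tensorRightHomEquiv_whiskerRight_comp_evaluation _ _ _ Y' Z ⟨Y⟩ b
  have h3 := ha.symm.trans (h2.trans hb)
  rwa [cancel_mono] at h3

theorem leftDualIso_ev {X₁ X₂ Y : D} (p₁ : ExactPairing X₁ Y) (p₂ : ExactPairing X₂ Y) :
   Y ◁ (leftDualIso p₁ p₂).hom ≫ ε_ X₂ Y = ε_ X₁ Y := by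
  have := @leftAdjointMate_comp_evaluation _ _ _ Y Y ⟨X₂⟩ ⟨X₁⟩ (𝟙 Y)
  exact this.trans (by simp)

/-- dual functor -/
noncomputable def dL (D : Type u₂) [Category.{v₂} D] [MonoidalCategory D] [RigidCategory D] :
    D ⥤ Dᵒᵖ where
  obj X := Opposite.op (ᘁX)
  map f := (ᘁf).op
  map_comp f g := by simp [comp_leftAdjointMate]

/-- natural iso of contravariant functors from compatible pairings -/
noncomputable def dualNatIso {A : Type*} [Category A] {T : A ⥤ D} (S : A ⥤ Dᵒᵖ)
    (p : ∀ a, ExactPairing (S.obj a).unop (T.obj a))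
    (hp : ∀ {a b : A} (f : a ⟶ b), T.obj a ◁ (S.map f).unop ≫ ε_ (S.obj a).unop (T.obj a) =
      T.map f ▷ (S.obj b).unop ≫ ε_ (S.obj b).unop (T.obj b)) : T ⋙ dL D ≅ S :=
  NatIso.ofComponents (fun a => (leftDualIso (p a) (X₂ := ᘁ(T.obj a)) HasLeftDual.exact).op) (by
    intro a b f
    apply Quiver.Hom.unop_inj
    apply mate_ext (X := T.obj a) (X' := ᘁ(T.obj a))
    have h1 := leftDualIso_ev (p a) (X₂ := ᘁ(T.obj a)) HasLeftDual.exact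
    have h2 := leftDualIso_ev (p b) (X₂ := ᘁ(T.obj b)) HasLeftDual.exact
    have h3 := leftAdjointMate_comp_evaluation (T.map f)
    change T.obj a ◁ ((leftDualIso (p b) HasLeftDual.exact).hom ≫ ᘁ(T.map f)) ≫ ε_ _ _ =
      T.obj a ◁ ((S.map f).unop ≫ (leftDualIso (p a) HasLeftDual.exact).hom) ≫ ε_ _ _
    rw [MonoidalCategory.whiskerLeft_comp_assoc, MonoidalCategory.whiskerLeft_comp_assoc, h1, h3,
      whisker_exchange_assoc, h2, hp])

theorem la_ra {X Y : D} (f : X ⟶ Y) :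
   @rightAdjointMate _ _ _ (ᘁY) (ᘁX) hasRightDualLeftDual hasRightDualLeftDual (ᘁf) = f := by
  have h1 := @rightAdjointMate_comp_evaluation _ _ _ (ᘁY) (ᘁX) hasRightDualLeftDual hasRightDualLeftDual (ᘁf)
  have h2 := leftAdjointMate_comp_evaluation f
  exact mate_ext' (Y' := ᘁY) (h1.trans h2)

theorem ra_la {X Y : D} (f : (ᘁX) ⟶ (ᘁY)) :
   (ᘁ(@rightAdjointMate _ _ _ (ᘁX) (ᘁY) hasRightDualLeftDual hasRightDualLeftDual f)) = f := by
  have h1 := @rightAdjointMate_comp_evaluation _ _ _ (ᘁX) (ᘁY) hasRightDualLeftDual hasRightDualLeftDual f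
  have h2 := leftAdjointMate_comp_evaluation
    (@rightAdjointMate _ _ _ (ᘁX) (ᘁY) hasRightDualLeftDual hasRightDualLeftDual f)
  exact mate_ext (X' := ᘁY) (h2.trans h1)

instance : (dL D).Faithful where
  map_injective {X Y f g} h := by
    have : (ᘁf) = ᘁg := Quiver.Hom.op_inj h
    rw [← la_ra f, ← la_ra g, this]

instance : (dL D).Full where
  map_surjective {X Y} f := ⟨@rightAdjointMate _ _ _ (ᘁY) (ᘁX) hasRightDualLeftDual
    hasRightDualLeftDual f.unop, Quiver.Hom.unop_inj (ra_la (X := Y) (Y := X) f.unop)⟩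

instance : (dL D).EssSurj where
  mem_essImage Z := ⟨Z.unopᘁ, ⟨(leftDualIso (X₁ := Z.unop) (Y := Z.unopᘁ) HasRightDual.exact
    (LeftRigidCategory.leftDual (Z.unopᘁ)).exact).op⟩⟩

instance : (dL D).IsEquivalence where

/-- F commutes with duals -/
noncomputable def F_dL (F : C ⥤ D) [F.Monoidal] : F ⋙ dL D ≅ dL C ⋙ F.op :=
  dualNatIso (T := F) (dL C ⋙ F.op) (fun X => mapPairing F (ᘁX) X) (fun f =>
    map_crit F f (ᘁf) (leftAdjointMate_comp_evaluation f))

noncomputable def tl_dL (A A' : D) [ExactPairing A' A] :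
    tensorLeft A ⋙ dL D ≅ dL D ⋙ (tensorRight A').op :=
  dualNatIso (T := tensorLeft A) (dL D ⋙ (tensorRight A').op)
    (fun X => ExactPairing.tensor (X₁ := ᘁX) (X₂ := A') (Y₁ := X) (Y₂ := A)) (fun {a b} f => by
    have h := leftAdjointMate_comp_evaluation f
    change (A ⊗ a) ◁ ((ᘁf) ▷ A') ≫ ε_ ((ᘁa) ⊗ A') (A ⊗ a) = (A ◁ f) ▷ ((ᘁb) ⊗ A') ≫ ε_ ((ᘁb) ⊗ A') (A ⊗ b)
    rw [ExactPairing.tensor_evaluation, ExactPairing.tensor_evaluation]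
    calc _ = 𝟙 _ ⊗≫ A ◁ ((a ◁ (ᘁf) ≫ ε_ (ᘁa) a) ▷ A') ⊗≫ ε_ A' A := by monoidal
      _ = _ := by rw [h]; monoidal)

noncomputable def tr_dL (A A' : D) [ExactPairing A' A] :
    tensorRight A ⋙ dL D ≅ dL D ⋙ (tensorLeft A').op :=
  dualNatIso (T := tensorRight A) (dL D ⋙ (tensorLeft A').op)
    (fun X => ExactPairing.tensor (X₁ := A') (X₂ := ᘁX) (Y₁ := A) (Y₂ := X)) (fun {a b} f => by
    have h := leftAdjointMate_comp_evaluation f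
    change (a ⊗ A) ◁ (A' ◁ (ᘁf)) ≫ ε_ (A' ⊗ ᘁa) (a ⊗ A) = (f ▷ A) ▷ (A' ⊗ ᘁb) ≫ ε_ (A' ⊗ (ᘁb)) (b ⊗ A)
    rw [ExactPairing.tensor_evaluation, ExactPairing.tensor_evaluation]
    calc _ = 𝟙 _ ⊗≫ a ◁ ((A ⊗ A') ◁ (ᘁf) ≫ ε_ A' A ▷ (ᘁa)) ⊗≫ ε_ (ᘁa) a := by monoidal
      _ = 𝟙 _ ⊗≫ a ◁ (ε_ A' A ▷ (ᘁb)) ⊗≫ (a ◁ (ᘁf) ≫ ε_ (ᘁa) a) := by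
        rw [whisker_exchange]; monoidal
      _ = 𝟙 _ ⊗≫ (a ◁ (ε_ A' A ▷ (ᘁb) ≫ (λ_ _).hom) ≫ f ▷ _) ⊗≫ ε_ (ᘁb) b := by rw [h]; monoidal
      _ = _ := by rw [whisker_exchange]; monoidal)

section proj
variable {A B : Type*} [Category A] [Category B] {T : A ⥤ B} {S : B ⥤ A} (adjT : T ⊣ S)

/-- mates -/
def projIso {lA rA : A ⥤ A} {lB rB : B ⥤ B} (adjA : lA ⊣ rA) (adjB : lB ⊣ rB)
    (τ : lA ⋙ T ≅ T ⋙ lB) : rB ⋙ S ≅ S ⋙ rA :=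
  conjugateIsoEquiv (adjT.comp adjB) (adjA.comp adjT) τ

theorem proj_nat {lA rA lA' rA' : A ⥤ A} {lB rB lB' rB' : B ⥤ B} (adjA : lA ⊣ rA) (adjB : lB ⊣ rB)
    (adjA' : lA' ⊣ rA') (adjB' : lB' ⊣ rB')
    (τ : lA ⋙ T ≅ T ⋙ lB) (τ' : lA' ⋙ T ≅ T ⋙ lB') (a : lA' ⟶ lA) (b : lB' ⟶ lB)
    (h : Functor.whiskerRight a T ≫ τ.hom = τ'.hom ≫ Functor.whiskerLeft T b) :
    (projIso adjT adjA adjB τ).hom ≫ Functor.whiskerLeft S (conjugateEquiv adjA adjA' a) =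
    Functor.whiskerRight (conjugateEquiv adjB adjB' b) S ≫ (projIso adjT adjA' adjB' τ').hom := by
  simp only [projIso, conjugateIsoEquiv_apply_hom]
  rw [← conjugateEquiv_whiskerRight _ _ adjT, ← conjugateEquiv_whiskerLeft _ _ adjT,
    conjugateEquiv_comp, conjugateEquiv_comp, h]
end proj

/-- monoidality -/
def tau (F : C ⥤ D) [F.Monoidal] (X : C) : tensorRight X ⋙ F ≅ F ⋙ tensorRight (F.obj X) :=
  NatIso.ofComponents (fun Y => (Functor.Monoidal.μIso F Y X).symm) (by intros; simp)

noncomputable def kappa (F : C ⥤ D) [F.Monoidal] {R : D ⥤ C} (adjR : F ⊣ R) (X : C) :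
    tensorRight (F.obj X) ⋙ R ≅ R ⋙ tensorRight X :=
  letI := mapPairing F (ᘁX) X
  projIso adjR (tensorRightAdjunction (ᘁX) X) (tensorRightAdjunction (F.obj (ᘁX)) (F.obj X))
    (tau F (ᘁX))

theorem kappa_nat (F : C ⥤ D) [F.Monoidal] {R : D ⥤ C} (adjR : F ⊣ R) {X Y : C} (f : X ⟶ Y) :
    (kappa F adjR X).hom ≫ Functor.whiskerLeft R ((tensoringRight C).map f) =
    Functor.whiskerRight ((tensoringRight D).map (F.map f)) R ≫ (kappa F adjR Y).hom := by
  let := mapPairing F (ᘁX) X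
  let := mapPairing F (ᘁY) Y
  have h := leftAdjointMate_comp_evaluation f
  rw [← conj_tensorRight f (ᘁf) h, ← conj_tensorRight (F.map f) (F.map (ᘁf)) (map_crit F f (ᘁf) h)]
  apply proj_nat
  ext Z
  simp [tau]

noncomputable def gam (F : C ⥤ D) [F.Monoidal] {R : D ⥤ C} (adjR : F ⊣ R) {G : C ⥤ D} (adjG : R ⊣ G)
    (X : C) : tensorRight X ⋙ G ≅ G ⋙ tensorRight (F.obj X) :=
  letI := mapPairing F (ᘁX) X
  projIso adjG (tensorRightAdjunction (F.obj (ᘁX)) (F.obj X)) (tensorRightAdjunction (ᘁX) X)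
    (kappa F adjR (ᘁX))

theorem gam_nat (F : C ⥤ D) [F.Monoidal] {R : D ⥤ C} (adjR : F ⊣ R) {G : C ⥤ D} (adjG : R ⊣ G)
    {X Y : C} (f : X ⟶ Y) :
    (gam F adjR adjG X).hom ≫ Functor.whiskerLeft G ((tensoringRight D).map (F.map f)) =
    Functor.whiskerRight ((tensoringRight C).map f) G ≫ (gam F adjR adjG Y).hom := by
  let := mapPairing F (ᘁX) X
  let := mapPairing F (ᘁY) Y
  have h := leftAdjointMate_comp_evaluation f
  rw [← conj_tensorRight f (ᘁf) h, ← conj_tensorRight (F.map f) (F.map (ᘁf)) (map_crit F f (ᘁf) h)]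
  apply proj_nat
  exact (kappa_nat F adjR (ᘁf)).symm

noncomputable def G_left (F : C ⥤ D) [F.Monoidal] {R : D ⥤ C} (adjR : F ⊣ R) {G : C ⥤ D}
    (adjG : R ⊣ G) : G ≅ F ⋙ tensorLeft (G.obj (𝟙_ C)) :=
  NatIso.ofComponents (fun X => G.mapIso (λ_ X).symm ≪≫ (gam F adjR adjG X).app (𝟙_ C)) (by
    intro X Y f
    have h := congrArg (fun t => t.app (𝟙_ C)) (gam_nat F adjR adjG f)
    simp only [NatTrans.comp_app, Functor.whiskerLeft_app, Functor.whiskerRight_app] at h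
    change G.map f ≫ G.map (λ_ Y).inv ≫ (gam F adjR adjG Y).hom.app _ =
      (G.map (λ_ X).inv ≫ (gam F adjR adjG X).hom.app _) ≫ G.obj (𝟙_ C) ◁ F.map f
    rw [Category.assoc]
    refine Eq.trans ?_ (congrArg (fun t => G.map (λ_ X).inv ≫ t) h.symm)
    change _ = G.map (λ_ X).inv ≫ G.map (𝟙_ C ◁ f) ≫ _
    rw [← G.map_comp_assoc, ← G.map_comp_assoc, leftUnitor_inv_naturality])

section dual
variable (F : C ⥤ D) [F.Monoidal] {L R : D ⥤ C} (adjL : L ⊣ F) (adjR : F ⊣ R)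

noncomputable def inv_F : (dL C).inv ⋙ F ≅ F.op ⋙ (dL D).inv :=
  Functor.isoWhiskerLeft (dL C).inv
    ((Functor.rightUnitor F).symm ≪≫
      Functor.isoWhiskerLeft F (dL D).asEquivalence.unitIso ≪≫ (Functor.associator _ _ _).symm ≪≫
      Functor.isoWhiskerRight (F_dL F) (dL D).inv) ≪≫
    (Functor.associator _ _ _).symm ≪≫
    Functor.isoWhiskerRight ((Functor.associator _ _ _).symm ≪≫
      Functor.isoWhiskerRight (dL C).asEquivalence.counitIso F.op ≪≫ Functor.leftUnitor _)
      (dL D).inv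

noncomputable def L_dL : L ⋙ dL C ≅ dL D ⋙ R.op :=
  (conjugateIsoEquiv (((dL D).asEquivalence.toAdjunction).comp adjR.op)
    (adjL.comp (dL C).asEquivalence.toAdjunction)).symm (inv_F F).symm

noncomputable def R_dL : R ⋙ dL C ≅ dL D ⋙ L.op :=
  conjugateIsoEquiv ((dL C).asEquivalence.symm.toAdjunction.comp adjR)
    (adjL.op.comp (dL D).asEquivalence.symm.toAdjunction) (inv_F F).symm

noncomputable def cancel_dL {S T : D ⥤ C} (i : dL D ⋙ S.op ≅ dL D ⋙ T.op) : T ≅ S :=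
  NatIso.removeOp ((Functor.leftUnitor _).symm ≪≫
    Functor.isoWhiskerRight (dL D).asEquivalence.counitIso.symm S.op ≪≫
    Functor.associator _ _ _ ≪≫ Functor.isoWhiskerLeft (dL D).inv i ≪≫
    (Functor.associator _ _ _).symm ≪≫
    Functor.isoWhiskerRight (dL D).asEquivalence.counitIso T.op ≪≫ Functor.leftUnitor _)

end dual

theorem dual_conj (F : C ⥤ D) [F.Monoidal] {L R : D ⥤ C} (adjL : L ⊣ F) (adjR : F ⊣ R) {M N : D ⥤ D} (e : R ≅ M ⋙ L) (m : M ⋙ dL D ≅ dL D ⋙ N.op) :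
    Nonempty (L ≅ N ⋙ R) := by
  have i : dL D ⋙ L.op ≅ dL D ⋙ (N ⋙ R).op :=
    (R_dL F adjL adjR).symm ≪≫ Functor.isoWhiskerRight e (dL C) ≪≫ Functor.associator _ _ _ ≪≫
    Functor.isoWhiskerLeft M (L_dL F adjL adjR) ≪≫ (Functor.associator _ _ _).symm ≪≫
    Functor.isoWhiskerRight m R.op ≪≫ Functor.associator _ _ _
  exact ⟨(cancel_dL i).symm⟩

end S6

theorem stmt_6 (F : C ⥤ D) [F.Monoidal] (L R : D ⥤ C) (G : C ⥤ D)
    (adjL : L ⊣ F) (adjR : F ⊣ R) (adjG : R ⊣ G) (χ : D)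
    (e : R ≅ tensorRight χ ⋙ L) :
    Nonempty (R ≅ tensorLeft χ ⋙ L) ∧
    Nonempty (L ≅ tensorLeft (χᘁ) ⋙ R) ∧
    Nonempty (L ≅ tensorRight (χᘁ) ⋙ R) := by
  let P := (χᘁ)ᘁ
  let pP : ExactPairing (χᘁ) P := (RightRigidCategory.rightDual (χᘁ)).exact
  let Q : D := ᘁ(ᘁχ)
  let pQ : ExactPairing Q (ᘁχ) := (LeftRigidCategory.leftDual (ᘁχ)).exact
  have iA : G ≅ F ⋙ tensorRight (χᘁ) :=
    conjugateIsoEquiv adjG ((tensorRightAdjunction χ (χᘁ)).comp adjL) e.symm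
  have i1 : 𝟙_ D ≅ F.obj (𝟙_ C) := Functor.Monoidal.εIso F
  have iG1 : G.obj (𝟙_ C) ≅ χᘁ :=
    iA.app (𝟙_ C) ≪≫ whiskerRightIso i1.symm (χᘁ) ≪≫ λ_ _
  have iB : G ≅ F ⋙ tensorLeft (χᘁ) := S6.G_left F adjR adjG ≪≫
    Functor.isoWhiskerLeft F ((tensoringLeft D).mapIso iG1)
  have e' : R ≅ tensorLeft P ⋙ L :=
    (conjugateIsoEquiv adjG ((tensorLeftAdjunction (χᘁ) P).comp adjL)).symm iB |>.symm
  obtain ⟨i3⟩ := S6.dual_conj F adjL adjR e' (S6.tl_dL P (χᘁ))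
  obtain ⟨i4⟩ := S6.dual_conj F adjL adjR e (S6.tr_dL χ (ᘁχ))
  have j3 : F ≅ G ⋙ tensorRight P :=
    conjugateIsoEquiv adjL ((tensorRightAdjunction (χᘁ) P).comp adjG) i3.symm
  have j4 : F ≅ G ⋙ tensorLeft Q :=
    conjugateIsoEquiv adjL ((tensorLeftAdjunction Q (ᘁχ)).comp adjG) i4.symm
  have k3 : 𝟙_ D ≅ χᘁ ⊗ P := i1 ≪≫ j3.app _ ≪≫ whiskerRightIso iG1 P
  have k4 : 𝟙_ D ≅ Q ⊗ χᘁ := i1 ≪≫ j4.app _ ≪≫ whiskerLeftIso Q iG1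
  have QP : Q ≅ P := (ρ_ Q).symm ≪≫ whiskerLeftIso Q k3 ≪≫ (α_ _ _ _).symm ≪≫
    whiskerRightIso k4.symm P ≪≫ λ_ P
  have k5 : 𝟙_ D ≅ P ⊗ χᘁ := k4 ≪≫ whiskerRightIso QP _
  have tl : ∀ A B : D, (𝟙_ D ≅ A ⊗ B) → (𝟭 D ≅ tensorLeft B ⋙ tensorLeft A) := fun A B i =>
    (leftUnitorNatIso D).symm ≪≫ (tensoringLeft D).mapIso i ≪≫ tensorLeftTensor A B
  let E : D ≌ D := CategoryTheory.Equivalence.mk (tensorLeft (χᘁ)) (tensorLeft P) (tl P _ k5) (tl _ P k3).symm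
  have χP : χ ≅ P := (ρ_ χ).symm ≪≫
    ((tensorLeftAdjunction χ (χᘁ)).rightAdjointUniq E.toAdjunction).app (𝟙_ D) ≪≫ ρ_ P
  have j2 : F ≅ G ⋙ tensorLeft χ := (Functor.rightUnitor F).symm ≪≫
    Functor.isoWhiskerLeft F (tl χ (χᘁ) (k5 ≪≫ whiskerRightIso χP.symm _)) ≪≫
    (Functor.associator _ _ _).symm ≪≫ Functor.isoWhiskerRight iB.symm (tensorLeft χ)
  refine ⟨⟨e' ≪≫ Functor.isoWhiskerRight ((tensoringLeft D).mapIso χP.symm) L⟩, ⟨?_⟩, ⟨i3⟩⟩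
  exact ((conjugateIsoEquiv adjL ((tensorLeftAdjunction χ (χᘁ)).comp adjG)).symm j2).symm
end

section
/- Let F : C → D be a strong monoidal functor between rigid monoidal categories with adjoints L ⊣ F ⊣ R and with relative modular object χ (i.e., R ≅ L(- ⊗ χ)). Then χ is an invertible object: χ ⊗ χ^* ≅ 𝟙 ≅ χ^* ⊗ χ. -/
open CategoryTheory MonoidalCategory

universe v₁ v₂ u₁ u₂

variable {C : Type u₁} [Category.{v₁} C] [MonoidalCategory C] [RigidCategory C]
variable {D : Type u₂} [Category.{v₂} D] [MonoidalCategory D] [RigidCategory D]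

section Helpers

open ExactPairing Functor.LaxMonoidal Functor.OplaxMonoidal

section Mate

variable {A : Type u₁} [Category.{v₁} A] [MonoidalCategory A]

/-- `g` is the mate of `f` with respect to the two pairings. -/
def IsMate {X X' Y Y' : A} (p : ExactPairing X X') (q : ExactPairing Y Y')
    (f : X ⟶ Y) (g : Y' ⟶ X') : Prop :=
  η_ X X' ≫ f ▷ X' = η_ Y Y' ≫ Y ◁ g

/-- The mate bijection. -/
def pMate {X X' Y Y' : A} (p : ExactPairing X X') (q : ExactPairing Y Y') :
    (X ⟶ Y) ≃ (Y' ⟶ X') :=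
  ((((λ_ X).symm.homFromEquiv).trans (tensorRightHomEquiv (𝟙_ A) X X' Y)).trans
    (tensorLeftHomEquiv (𝟙_ A) Y Y' X').symm).trans (ρ_ Y').homFromEquiv

lemma pMate_eq_iff {X X' Y Y' : A} (p : ExactPairing X X') (q : ExactPairing Y Y')
    (f : X ⟶ Y) (g : Y' ⟶ X') : pMate p q f = g ↔ IsMate p q f g := by
  have h : tensorLeftHomEquiv (𝟙_ A) Y Y' X' ((ρ_ Y').hom ≫ g) = η_ Y Y' ≫ Y ◁ g := by
    rw [← tensorLeftHomEquiv_symm_coevaluation_comp_whiskerLeft (Y := Y) (Y' := Y') g,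
      Equiv.apply_symm_apply]
  have h' : tensorRightHomEquiv (𝟙_ A) X X' Y ((λ_ X).hom ≫ f) = η_ X X' ≫ f ▷ X' := by
    simp [tensorRightHomEquiv, ← unitors_inv_equal]
  unfold IsMate
  rw [← h, ← h', ← Equiv.symm_apply_eq]
  simp [pMate, Iso.homFromEquiv, Iso.inv_comp_eq]

lemma IsMate.comp {X X' Y Y' Z Z' : A} {p : ExactPairing X X'} {q : ExactPairing Y Y'}
    {r : ExactPairing Z Z'} {f : X ⟶ Y} {g : Y' ⟶ X'} {f₂ : Y ⟶ Z} {g₂ : Z' ⟶ Y'}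
    (h : IsMate p q f g) (h₂ : IsMate q r f₂ g₂) : IsMate p r (f ≫ f₂) (g₂ ≫ g) := by
  unfold IsMate at *
  rw [comp_whiskerRight, reassoc_of% h, whisker_exchange, reassoc_of% h₂,
    MonoidalCategory.whiskerLeft_comp]

lemma pMate_comp {X X' Y Y' Z Z' : A} (p : ExactPairing X X') (q : ExactPairing Y Y')
    (r : ExactPairing Z Z') (f : X ⟶ Y) (f₂ : Y ⟶ Z) :
    pMate p r (f ≫ f₂) = pMate q r f₂ ≫ pMate p q f :=
  (pMate_eq_iff ..).2 (IsMate.comp ((pMate_eq_iff ..).1 rfl) ((pMate_eq_iff ..).1 rfl))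

lemma pMate_symm_comp {X X' Y Y' Z Z' : A} (p : ExactPairing X X') (q : ExactPairing Y Y')
    (r : ExactPairing Z Z') (g : Y' ⟶ X') (g₂ : Z' ⟶ Y') :
    (pMate p r).symm (g₂ ≫ g) = (pMate p q).symm g ≫ (pMate q r).symm g₂ := by
  rw [Equiv.symm_apply_eq, pMate_comp p q r]; simp

lemma IsMate.eq {X X' Y Y' : A} {p : ExactPairing X X'} {q : ExactPairing Y Y'}
    {f : X ⟶ Y} {g : Y' ⟶ X'} (h : IsMate p q f g) : pMate p q f = g := (pMate_eq_iff ..).2 h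

lemma IsMate.symm_eq {X X' Y Y' : A} {p : ExactPairing X X'} {q : ExactPairing Y Y'}
    {f : X ⟶ Y} {g : Y' ⟶ X'} (h : IsMate p q f g) : (pMate p q).symm g = f := by
  rw [Equiv.symm_apply_eq, h.eq]

lemma IsMate.tensorR {X X' Y Y' Z Z' : A} {p : ExactPairing X X'} {q : ExactPairing Y Y'}
    {f : X ⟶ Y} {g : Y' ⟶ X'} (h : IsMate p q f g) (r : ExactPairing Z Z') :
    IsMate (ExactPairing.tensor (X₁ := X) (X₂ := Z) (Y₁ := X') (Y₂ := Z'))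
      (ExactPairing.tensor (X₁ := Y) (X₂ := Z) (Y₁ := Y') (Y₂ := Z')) (f ▷ Z) (Z' ◁ g) := by
  unfold IsMate at *
  rw [ExactPairing.tensor_coevaluation, ExactPairing.tensor_coevaluation]
  calc
    _ = η_ X X' ⊗≫ ((X ◁ η_ Z Z') ≫ f ▷ (Z ⊗ Z')) ▷ X' ⊗≫ 𝟙 _ := by monoidal
    _ = (η_ X X' ≫ f ▷ X') ⊗≫ (Y ◁ η_ Z Z') ▷ X' ⊗≫ 𝟙 _ := by
      rw [whisker_exchange]; monoidal
    _ = η_ Y Y' ⊗≫ (((Y ⊗ 𝟙_ A) ◁ g) ≫ (Y ◁ η_ Z Z') ▷ X') ⊗≫ 𝟙 _ := by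
      rw [h]; monoidal
    _ = _ := by
      rw [whisker_exchange]; monoidal

lemma IsMate.tensorL {X X' Y Y' Z Z' : A} {p : ExactPairing X X'} {q : ExactPairing Y Y'}
    {f : X ⟶ Y} {g : Y' ⟶ X'} (h : IsMate p q f g) (r : ExactPairing Z Z') :
    IsMate (ExactPairing.tensor (X₁ := Z) (X₂ := X) (Y₁ := Z') (Y₂ := X'))
      (ExactPairing.tensor (X₁ := Z) (X₂ := Y) (Y₁ := Z') (Y₂ := Y')) (Z ◁ f) (g ▷ Z') := by
  unfold IsMate at *
  rw [ExactPairing.tensor_coevaluation, ExactPairing.tensor_coevaluation]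
  calc
    _ = η_ Z Z' ⊗≫ (Z ◁ (η_ X X' ≫ f ▷ X')) ▷ Z' ⊗≫ 𝟙 _ := by monoidal
    _ = _ := by
      rw [h]; monoidal

end Mate

/-- `T'` is the dual of `T`, in a weak sense. -/
structure DualFun (T T' : C ⥤ D) where
  pair : ∀ X : C, ExactPairing (T.obj (ᘁX)) (T'.obj X)
  mate : ∀ {X Y : C} (f : X ⟶ Y), IsMate (pair Y) (pair X) (T.map (ᘁf)) (T'.map f)

lemma isMate_left {X Y : C} (f : X ⟶ Y) :
    IsMate (inferInstance : ExactPairing (ᘁY) Y) (inferInstance : ExactPairing (ᘁX) X) (ᘁf) f :=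
  coevaluation_comp_leftAdjointMate f

lemma isMate_right {X Y : C} (f : X ⟶ Y) :
    IsMate (inferInstance : ExactPairing X Xᘁ) (inferInstance : ExactPairing Y Yᘁ) f (fᘁ) :=
  (coevaluation_comp_rightAdjointMate f).symm

/-- `shriek'` is a dual. -/
noncomputable def dualFunShriek (T : C ⥤ D) : DualFun T (shriek' T) where
  pair X := (inferInstance : ExactPairing (T.obj (ᘁX)) (T.obj (ᘁX))ᘁ)
  mate f := isMate_right (T.map (ᘁf))

/-- Dualizing an adjunction. -/
noncomputable def dualAdj {A A' : C ⥤ D} {B B' : D ⥤ C} (a : DualFun A A') (b : DualFun B B')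
    (adj : A ⊣ B) : B' ⊣ A' :=
  Adjunction.mkOfHomEquiv
    { homEquiv := fun V X =>
        ((pMate (inferInstance : ExactPairing (ᘁX) X) (b.pair V)).symm.trans
          (adj.homEquiv (ᘁX) (ᘁV)).symm).trans
          (pMate (a.pair X) (inferInstance : ExactPairing (ᘁV) V))
      homEquiv_naturality_left_symm := by
        intro V V' X f g
        simp only [Equiv.symm_trans_apply, Equiv.symm_symm]
        rw [pMate_symm_comp _ _ _ g f, (isMate_left f).symm_eq, adj.homEquiv_naturality_right,
          pMate_comp _ (b.pair V') _, (b.mate f).eq]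
      homEquiv_naturality_right := by
        intro V X X' f g
        simp only [Equiv.trans_apply]
        rw [pMate_symm_comp _ _ _ g f, (isMate_left g).symm_eq,
          adj.homEquiv_naturality_left_symm, pMate_comp _ (a.pair X) _, (a.mate g).eq] }

/-- image of a pairing under a strong monoidal functor. -/
@[reducible]
def mapPair (F : C ⥤ D) [F.Monoidal] {X X' : C}
    (p : ExactPairing X X') :
    ExactPairing (F.obj X) (F.obj X') where
  coevaluation' := ε F ≫ F.map (η_ X X') ≫ δ F X X'
  evaluation' := μ F X' X ≫ F.map (ε_ X X') ≫ η F
  coevaluation_evaluation' := by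
    have h : F.obj X' ◁ F.map (η_ X X') ≫ F.obj X' ◁ δ F X X' ≫
        (α_ (F.obj X') (F.obj X) (F.obj X')).inv ≫ μ F X' X ▷ F.obj X' ≫
        F.map (ε_ X X') ▷ F.obj X' =
        μ F _ _ ≫ F.map (ρ_ X').hom ≫ F.map (λ_ X').inv ≫ δ F _ _ := by
      rw [← F.map_comp_assoc, ← coevaluation_evaluation X X']
      simp only [Functor.map_comp, Functor.Monoidal.map_whiskerLeft,
        Functor.Monoidal.map_whiskerRight, Functor.Monoidal.map_associator_inv, Category.assoc,
        Functor.Monoidal.μ_δ_assoc, Functor.Monoidal.μ_δ, Category.comp_id]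
    simp only [MonoidalCategory.whiskerLeft_comp, comp_whiskerRight, Category.assoc,
      reassoc_of% h]
    simp
  evaluation_coevaluation' := by
    have h : F.map (η_ X X') ▷ F.obj X ≫ δ F X X' ▷ F.obj X ≫
        (α_ (F.obj X) (F.obj X') (F.obj X)).hom ≫ F.obj X ◁ μ F X' X ≫
        F.obj X ◁ F.map (ε_ X X') =
        μ F _ _ ≫ F.map (λ_ X).hom ≫ F.map (ρ_ X).inv ≫ δ F _ _ := by
      rw [← F.map_comp_assoc, ← evaluation_coevaluation X X']
      simp only [Functor.map_comp, Functor.Monoidal.map_whiskerLeft,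
        Functor.Monoidal.map_whiskerRight, Functor.Monoidal.map_associator, Category.assoc,
        Functor.Monoidal.μ_δ_assoc, Functor.Monoidal.μ_δ, Category.comp_id]
    simp only [MonoidalCategory.whiskerLeft_comp, comp_whiskerRight, Category.assoc,
      reassoc_of% h]
    simp

def dualF (F : C ⥤ D) [F.Monoidal] : DualFun F F where
  pair X := mapPair F inferInstance
  mate f := by
    have h := congrArg F.map (isMate_left f)
    simp only [Functor.map_comp, Functor.Monoidal.map_whiskerLeft,
      Functor.Monoidal.map_whiskerRight] at h
    change (ε F ≫ F.map _ ≫ δ F _ _) ≫ _ = (ε F ≫ F.map _ ≫ δ F _ _) ≫ _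
    rw [← cancel_mono (μ F _ _)]
    simpa using congrArg (fun k => ε F ≫ k) h

def dualFR (F : C ⥤ D) [F.Monoidal] (Z Z' : D) [p : ExactPairing Z Z'] :
    DualFun (F ⋙ tensorRight Z) (F ⋙ tensorLeft Z') where
  pair X := @ExactPairing.tensor _ _ _ _ _ _ _ ((dualF F).pair X) p
  mate f := ((dualF F).mate f).tensorR p

def dualFL (F : C ⥤ D) [F.Monoidal] (Z Z' : D) [p : ExactPairing Z Z'] :
    DualFun (F ⋙ tensorLeft Z) (F ⋙ tensorRight Z') where
  pair X := @ExactPairing.tensor _ _ _ _ _ _ _ p ((dualF F).pair X)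
  mate f := ((dualF F).mate f).tensorL p

section Central

lemma isIso_of_yoneda_bij {A : Type u₁} [Category.{v₁} A] {X Y : A} (f : X ⟶ Y)
    (h : ∀ T : A, Function.Bijective (fun g : T ⟶ X => g ≫ f)) : IsIso f := by
  obtain ⟨g, hg⟩ := (h Y).2 (𝟙 Y)
  refine ⟨g, (h X).1 ?_, hg⟩
  have : g ≫ f = 𝟙 Y := hg
  simp [this]

variable (F : C ⥤ D) [F.Monoidal] {R : D ⥤ C} {G : C ⥤ D} (adjR : F ⊣ R) (adjG : R ⊣ G)

/-- the counit -/
def cu (V : D) : F.obj (R.obj V) ⟶ V := adjR.counit.app V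

lemma cu_nat {V V' : D} (f : V ⟶ V') : F.map (R.map f) ≫ cu F adjR V' = cu F adjR V ≫ f :=
  adjR.counit_naturality f

lemma homEquiv_symm_cu {X : C} {V : D} (f : X ⟶ R.obj V) :
    (adjR.homEquiv X V).symm f = F.map f ≫ cu F adjR V := adjR.homEquiv_counit ..

/-- projection morphism -/
def pmap (V : D) (Y : C) : R.obj V ⊗ Y ⟶ R.obj (V ⊗ F.obj Y) :=
  adjR.homEquiv _ _ (δ F _ _ ≫ cu F adjR V ▷ F.obj Y)

lemma pmap_counit (V : D) (Y : C) : F.map (pmap F adjR V Y) ≫ cu F adjR _ =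
    δ F _ _ ≫ cu F adjR V ▷ F.obj Y := by
  rw [← homEquiv_symm_cu, pmap, Equiv.symm_apply_apply]

lemma pmap_natV {V V' : D} (f : V ⟶ V') (Y : C) :
    R.map f ▷ Y ≫ pmap F adjR V' Y = pmap F adjR V Y ≫ R.map (f ▷ F.obj Y) := by
  unfold pmap
  rw [← adjR.homEquiv_naturality_left, ← adjR.homEquiv_naturality_right]
  congr 1
  rw [← δ_natural_left_assoc, ← comp_whiskerRight, Category.assoc, ← comp_whiskerRight,
    cu_nat]

lemma pmap_natY (V : D) {Y Y' : C} (f : Y ⟶ Y') :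
    R.obj V ◁ f ≫ pmap F adjR V Y' = pmap F adjR V Y ≫ R.map (V ◁ F.map f) := by
  unfold pmap
  rw [← adjR.homEquiv_naturality_left, ← adjR.homEquiv_naturality_right]
  congr 1
  rw [← δ_natural_right_assoc, Category.assoc, whisker_exchange]

instance pmap_isIso (V : D) (Y : C) : IsIso (pmap F adjR V Y) := by
  let _ := mapPair F (inferInstance : ExactPairing (ᘁY) Y)
  have key : ∀ (X : C) (k : X ⊗ (ᘁY) ⟶ R.obj V),
      F.map (tensorRightHomEquiv X (ᘁY) Y _ k) ≫ δ F _ _ ≫ cu F adjR V ▷ F.obj Y =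
      tensorRightHomEquiv (F.obj X) (F.obj (ᘁY)) (F.obj Y) V
        (μ F _ _ ≫ F.map k ≫ cu F adjR V) := by
    intro X k
    have hη : η_ (F.obj (ᘁY)) (F.obj Y) = ε F ≫ F.map (η_ (ᘁY) Y) ≫ δ F _ _ := rfl
    simp only [tensorRightHomEquiv, Equiv.coe_fn_mk, Functor.map_comp,
      Functor.Monoidal.map_whiskerLeft, Functor.Monoidal.map_associator_inv,
      Functor.Monoidal.map_whiskerRight, hη,
      Functor.Monoidal.map_rightUnitor_inv, Category.assoc, comp_whiskerRight,
      Functor.Monoidal.μ_δ_assoc, MonoidalCategory.whiskerLeft_comp]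
  have bij : ∀ X : C, Function.Bijective (fun g : X ⟶ R.obj V ⊗ Y => g ≫ pmap F adjR V Y) := by
    intro X
    let E : (X ⟶ R.obj V ⊗ Y) ≃ (X ⟶ R.obj (V ⊗ F.obj Y)) :=
      ((tensorRightHomEquiv X (ᘁY) Y (R.obj V)).symm.trans
        ((adjR.homEquiv _ _).symm.trans ((Functor.Monoidal.μIso F X (ᘁY)).symm.homFromEquiv.trans
          (tensorRightHomEquiv (F.obj X) (F.obj (ᘁY)) (F.obj Y) V)))).trans (adjR.homEquiv _ _)
    convert E.bijective using 1
    funext g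
    obtain ⟨k, rfl⟩ := (tensorRightHomEquiv X (ᘁY) Y _).surjective g
    simp only [E, Equiv.trans_apply, Equiv.symm_apply_apply]
    rw [← Equiv.symm_apply_eq, homEquiv_symm_cu, Functor.map_comp, Category.assoc, pmap_counit,
      key, homEquiv_symm_cu]
    rfl
  exact isIso_of_yoneda_bij _ bij

lemma pmap_key (V : D) (X X' : C) [p : ExactPairing X X'] :
    (ρ_ _).inv ≫ R.obj V ◁ η_ X X' ≫ (α_ _ _ _).inv ≫ pmap F adjR V X ▷ X' ≫
      pmap F adjR (V ⊗ F.obj X) X' =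
    R.map ((ρ_ _).inv ≫ V ◁ (ε F ≫ F.map (η_ X X') ≫ δ F X X') ≫ (α_ _ _ _).inv) := by
  apply (adjR.homEquiv _ _).symm.injective
  rw [homEquiv_symm_cu, homEquiv_symm_cu, cu_nat]
  simp only [Functor.map_comp, Category.assoc, pmap_counit]
  rw [← δ_natural_left_assoc, ← comp_whiskerRight, pmap_counit]
  simp only [Functor.Monoidal.map_whiskerLeft, Functor.Monoidal.map_associator_inv,
    Functor.Monoidal.map_rightUnitor_inv, Category.assoc, comp_whiskerRight,
    Functor.Monoidal.μ_δ_assoc, Functor.Monoidal.whiskerRight_μ_δ_assoc,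
    MonoidalCategory.whiskerLeft_comp]
  rw [← associator_inv_naturality_left, whisker_exchange_assoc, whisker_exchange_assoc,
    whisker_exchange_assoc, ← rightUnitor_inv_naturality_assoc]

noncomputable def smap (X : C) : G.obj (𝟙_ C) ⊗ F.obj X ⟶ G.obj X :=
  adjG.homEquiv _ _ (inv (pmap F adjR (G.obj (𝟙_ C)) X) ≫ adjG.counit.app (𝟙_ C) ▷ X ≫ (λ_ X).hom)

instance smap_isIso (X : C) : IsIso (smap F adjR adjG X) := by
  let _ := mapPair F (inferInstance : ExactPairing (ᘁX) X)
  apply isIso_of_yoneda_bij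
  intro V
  let E : (V ⟶ G.obj (𝟙_ C) ⊗ F.obj X) ≃ (V ⟶ G.obj X) :=
    ((tensorRightHomEquiv V (F.obj (ᘁX)) (F.obj X) (G.obj (𝟙_ C))).symm.trans
      ((adjG.homEquiv _ _).symm.trans ((asIso (pmap F adjR V (ᘁX))).symm.homFromEquiv.trans
        ((tensorRightHomEquiv (R.obj V) (ᘁX) X (𝟙_ C)).trans (λ_ X).homToEquiv)))).trans
      (adjG.homEquiv _ _)
  convert E.bijective using 1
  funext g
  obtain ⟨k, rfl⟩ := (tensorRightHomEquiv V (F.obj (ᘁX)) (F.obj X) (G.obj (𝟙_ C))).surjective g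
  simp only [E, Equiv.trans_apply, Equiv.symm_apply_apply]
  have hη : η_ (F.obj (ᘁX)) (F.obj X) = ε F ≫ F.map (η_ (ᘁX) X) ≫ δ F _ _ := rfl
  unfold smap
  rw [← adjG.homEquiv_naturality_left]
  congr 1
  have hk := pmap_key F adjR V (ᘁX) X
  rw [← hη] at hk
  have hn := pmap_natV F adjR k X
  have : R.map (tensorRightHomEquiv V (F.obj (ᘁX)) (F.obj X) (G.obj (𝟙_ C)) k) =
      ((ρ_ _).inv ≫ R.obj V ◁ η_ (ᘁX) X ≫ (α_ _ _ _).inv ≫ pmap F adjR V (ᘁX) ▷ X ≫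
        R.map k ▷ X) ≫ pmap F adjR (G.obj (𝟙_ C)) X := by
    simp only [Category.assoc]
    rw [hn, reassoc_of% hk, ← R.map_comp]
    simp [tensorRightHomEquiv]
  rw [this]
  simp [Iso.homFromEquiv, Iso.homToEquiv, tensorRightHomEquiv, adjG.homEquiv_counit]

noncomputable def centralIso : F ⋙ tensorLeft (G.obj (𝟙_ C)) ≅ G :=
  NatIso.ofComponents (fun X => asIso (smap F adjR adjG X)) (by
    intro X Y f
    have h := pmap_natY F adjR (G.obj (𝟙_ C)) f
    change G.obj (𝟙_ C) ◁ F.map f ≫ smap F adjR adjG Y = smap F adjR adjG X ≫ G.map f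
    unfold smap
    rw [← adjG.homEquiv_naturality_left, ← adjG.homEquiv_naturality_right]
    congr 1
    rw [← cancel_epi (pmap F adjR (G.obj (𝟙_ C)) X), ← reassoc_of% h]
    simp [whisker_exchange_assoc])

end Central

end Helpers

/-- The relative modular object is invertible: `χ ⊗ χ^* ≅ 𝟙 ≅ χ^* ⊗ χ`. -/
theorem stmt_7 (F : C ⥤ D) [F.Monoidal] (L R : D ⥤ C) (G : C ⥤ D)
    (adjL : L ⊣ F) (adjR : F ⊣ R) (adjG : R ⊣ G) (χ : D)
    (e : R ≅ tensorRight χ ⋙ L) :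
    Nonempty (χ ⊗ χᘁ ≅ 𝟙_ D) ∧ Nonempty (χᘁ ⊗ χ ≅ 𝟙_ D) := by
  have iL : L ≅ shriek' R := adjL.leftAdjointUniq (dualAdj (dualF F) (dualFunShriek R) adjR)
  have adj1 : R ⊣ F ⋙ tensorRight χᘁ :=
    ((tensorRightAdjunction χ χᘁ).comp adjL).ofNatIsoLeft e.symm
  have u : F.obj (𝟙_ C) ≅ 𝟙_ D := (Functor.Monoidal.εIso F).symm
  -- first half
  have i1 : L ≅ tensorLeft χᘁ ⋙ R :=
    iL ≪≫ (dualAdj (dualFunShriek R) (dualFR F χᘁ χᘁᘁ) adj1).rightAdjointUniq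
      (adjR.comp (tensorLeftAdjunction χᘁ χᘁᘁ))
  have j1 : L ≅ tensorLeft χᘁ ⋙ tensorRight χ ⋙ L := i1 ≪≫ Functor.isoWhiskerLeft _ e
  have k1 : F ≅ (F ⋙ tensorRight χᘁ) ⋙ tensorLeft χ :=
    (adjL.ofNatIsoLeft j1).rightAdjointUniq
      ((tensorLeftAdjunction χ χᘁ).comp ((tensorRightAdjunction χ χᘁ).comp adjL))
  have h1 : χ ⊗ χᘁ ≅ 𝟙_ D :=
    whiskerLeftIso χ ((λ_ _).symm ≪≫ whiskerRightIso u.symm _) ≪≫ (k1.app (𝟙_ C)).symm ≪≫ u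
  -- second half
  have adj2 : R ⊣ F ⋙ tensorLeft (G.obj (𝟙_ C)) :=
    adjG.ofNatIsoRight (centralIso F adjR adjG).symm
  generalize G.obj (𝟙_ C) = Z at adj2
  have i2 : L ≅ tensorRight Zᘁᘁ ⋙ R :=
    iL ≪≫ (dualAdj (dualFunShriek R) (dualFL F Z Zᘁ) adj2).rightAdjointUniq
      (adjR.comp (tensorRightAdjunction Zᘁ Zᘁᘁ))
  have j2 : L ≅ tensorRight Zᘁᘁ ⋙ tensorRight χ ⋙ L := i2 ≪≫ Functor.isoWhiskerLeft _ e
  have k2 : F ≅ (F ⋙ tensorRight χᘁ) ⋙ tensorRight Zᘁᘁᘁ :=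
    (adjL.ofNatIsoLeft j2).rightAdjointUniq
      ((tensorRightAdjunction Zᘁᘁ Zᘁᘁᘁ).comp ((tensorRightAdjunction χ χᘁ).comp adjL))
  obtain ⟨W, ⟨h2⟩⟩ : ∃ W : D, Nonempty (χᘁ ⊗ W ≅ 𝟙_ D) :=
    ⟨_, ⟨whiskerRightIso ((λ_ _).symm ≪≫ whiskerRightIso u.symm _) _ ≪≫
      (k2.app (𝟙_ C)).symm ≪≫ u⟩⟩
  have h3 : χ ≅ W :=
    (ρ_ χ).symm ≪≫ whiskerLeftIso χ h2.symm ≪≫ (α_ _ _ _).symm ≪≫ whiskerRightIso h1 _ ≪≫ λ_ _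
  exact ⟨⟨h1⟩, ⟨whiskerLeftIso _ h3 ≪≫ h2⟩⟩
end
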